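/- Let Ω ⊂ ℝ² be a nonempty bounded open set. There is no function f : cl(Ω) → ℝ that is continuous on the closure of Ω, twice continuously differentiable in Ω, equal to 0 at every point of ∂Ω, and satisfies det D²f(x) < 0 for every x ∈ Ω. -/

import Mathlib

open Set Metric

noncomputable section

/-- The Euclidean plane. -/
abbrev E2 := EuclideanSpace ℝ (Fin 2)

/-- The second partial derivative `∂²f/∂xᵢ∂xⱼ`. -/
def pderiv2 (i j : Fin 2) (f : E2 → ℝ) (x : E2) : ℝ :=
  fderiv ℝ (fun y => fderiv ℝ f y (EuclideanSpace.single j 1)) x (EuclideanSpace.single i 1)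

/-- The Hessian matrix `D²f` of a function on the plane. -/
def hess (f : E2 → ℝ) (x : E2) : Matrix (Fin 2) (Fin 2) ℝ :=
  Matrix.of fun i j => pderiv2 i j f x

open Filter Topology in
/-- Second-order necessary condition: the second derivative at a local maximum is
negative semidefinite. -/
theorem IsLocalMax.fderiv_fderiv_apply_self_nonpos {E : Type*} [NormedAddCommGroup E]
    [NormedSpace ℝ E] {f : E → ℝ} {x : E} (hmax : IsLocalMax f x) (hf : ContDiffAt ℝ 2 f x)
    (v : E) : fderiv ℝ (fderiv ℝ f) x v v ≤ 0 := by
  by_contra! hpos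
  have hline : ∀ t : ℝ, HasDerivAt (fun s : ℝ => x + s • v) v t := fun t => by
    simpa using ((hasDerivAt_id t).smul_const v).const_add x
  have htend : Tendsto (fun s : ℝ => x + s • v) (𝓝 0) (𝓝 x) := by
    simpa [ContinuousAt] using (hline 0).continuousAt
  have hderiv : ∀ᶠ s : ℝ in 𝓝 0,
      HasDerivAt (fun s : ℝ => f (x + s • v)) (fderiv ℝ f (x + s • v) v) s := by
    filter_upwards [htend.eventually (hf.eventually (by simp))] with s hs
    exact (hs.differentiableAt (by simp)).hasFDerivAt.comp_hasDerivAt s (hline s)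
  have hfx : DifferentiableAt ℝ (fderiv ℝ f) x :=
    (hf.fderiv_right (m := 1) (by norm_num)).differentiableAt (by simp)
  have hderiv₂ : HasDerivAt (fun s : ℝ => fderiv ℝ f (x + s • v) v)
      (fderiv ℝ (fderiv ℝ f) x v v) 0 := by
    have h : HasFDerivAt (fderiv ℝ f) (fderiv ℝ (fderiv ℝ f) x) (x + (0 : ℝ) • v) := by
      simpa using hfx.hasFDerivAt
    exact ((ContinuousLinearMap.apply ℝ ℝ v).hasFDerivAt.comp _ h).comp_hasDerivAt (0 : ℝ)
      (hline 0)
  have heq : deriv (fun s : ℝ => f (x + s • v)) =ᶠ[𝓝 0]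
      fun s => fderiv ℝ f (x + s • v) v := hderiv.mono fun s hs => hs.deriv
  have hmax₀ : IsLocalMax (fun s : ℝ => f (x + s • v)) 0 := by
    simpa [IsLocalMax, IsMaxFilter] using htend.eventually hmax
  have hmin₀ : IsLocalMin (fun s : ℝ => f (x + s • v)) 0 :=
    isLocalMin_of_deriv_deriv_pos (by rwa [heq.deriv_eq, hderiv₂.deriv]) hmax₀.deriv_eq_zero
      hderiv.self_of_nhds.continuousAt
  have hconst : (fun s : ℝ => f (x + s • v)) =ᶠ[𝓝 0] fun _ => f (x + (0 : ℝ) • v) := by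
    filter_upwards [hmax₀, hmin₀] with s h₁ h₂ using le_antisymm h₁ h₂
  have hzero := hconst.deriv.deriv_eq
  rw [heq.deriv_eq, hderiv₂.deriv] at hzero
  simp at hzero
  exact hpos.ne' hzero

theorem pderiv2_eq_fderiv_fderiv {f : E2 → ℝ} {x : E2}
    (hf : DifferentiableAt ℝ (fderiv ℝ f) x) (i j : Fin 2) :
    pderiv2 i j f x = fderiv ℝ (fderiv ℝ f) x (EuclideanSpace.single i 1)
      (EuclideanSpace.single j 1) := by
  have h := hf.hasFDerivAt.clm_apply
    (hasFDerivAt_const (EuclideanSpace.single j (1 : ℝ) : E2) x)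
  simp [pderiv2, h.fderiv]

/-- The Hessian determinant is nonnegative at a local maximum. -/
theorem IsLocalMax.det_hess_nonneg {f : E2 → ℝ} {x : E2} (hmax : IsLocalMax f x)
    (hf : ContDiffAt ℝ 2 f x) : 0 ≤ (hess f x).det := by
  have hfx : DifferentiableAt ℝ (fderiv ℝ f) x :=
    (hf.fderiv_right (m := 1) (by norm_num)).differentiableAt (by simp)
  have hquad : ∀ t : ℝ, -pderiv2 0 0 f x * (t * t) +
      -(pderiv2 0 1 f x + pderiv2 1 0 f x) * t + -pderiv2 1 1 f x ≥ 0 := fun t => by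
    have h := hmax.fderiv_fderiv_apply_self_nonpos hf
      (t • EuclideanSpace.single 0 1 + EuclideanSpace.single 1 1)
    simp only [map_add, map_smul, add_apply, smul_apply,
      smul_eq_mul, ← pderiv2_eq_fderiv_fderiv hfx] at h
    linarith
  have hdiscr := discrim_le_zero hquad
  rw [Matrix.det_fin_two]
  simp only [hess, Matrix.of_apply]
  unfold discrim at hdiscr
  nlinarith [sq_nonneg (pderiv2 0 1 f x - pderiv2 1 0 f x)]

theorem pderiv2_neg (i j : Fin 2) (f : E2 → ℝ) (x : E2) :
    pderiv2 i j (-f) x = -pderiv2 i j f x := by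
  have h : (fun y => fderiv ℝ (-f) y (EuclideanSpace.single j 1)) =
      -fun y => fderiv ℝ f y (EuclideanSpace.single j 1) := by
    ext y; simp [fderiv_neg]
  rw [pderiv2, h, fderiv_neg]
  rfl

/-- The Hessian determinant is nonnegative at a local minimum. -/
theorem IsLocalMin.det_hess_nonneg {f : E2 → ℝ} {x : E2} (hmin : IsLocalMin f x)
    (hf : ContDiffAt ℝ 2 f x) : 0 ≤ (hess f x).det := by
  have h := IsLocalMax.det_hess_nonneg (f := -f) hmin.neg hf.neg
  simpa [Matrix.det_fin_two, hess, pderiv2_neg] using h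

/-- **No saddle graph with vanishing boundary values.**  For a nonempty bounded open
set `Ω ⊂ ℝ²`, there is no function `f`, continuous on the closure of `Ω`, `C²` in `Ω`,
vanishing on `∂Ω`, with `det D²f < 0` throughout `Ω`. -/
theorem no_saddle_with_zero_boundary (Ω : Set E2) (hne : Ω.Nonempty)
    (hbd : Bornology.IsBounded Ω) (hop : IsOpen Ω) :
    ¬ ∃ f : E2 → ℝ,
        ContinuousOn f (closure Ω) ∧
        ContDiffOn ℝ 2 f Ω ∧
        (∀ x ∈ frontier Ω, f x = 0) ∧
        (∀ x ∈ Ω, (hess f x).det < 0) := by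
  rintro ⟨f, hcont, hdiff, hzero, hdet⟩
  have hC : ∀ x ∈ Ω, ContDiffAt ℝ 2 f x := fun x hx => hdiff.contDiffAt (hop.mem_nhds hx)
  have hcomp : IsCompact (closure Ω) := hbd.isCompact_closure
  have hfront : ∀ x ∈ closure Ω, x ∉ Ω → f x = 0 := fun x hx hxΩ =>
    hzero x (by rw [hop.frontier_eq]; exact ⟨hx, hxΩ⟩)
  obtain ⟨a, ha, hamax⟩ := hcomp.exists_isMaxOn hne.closure hcont
  obtain ⟨b, hb, hbmin⟩ := hcomp.exists_isMinOn hne.closure hcont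
  have hnhds : ∀ x ∈ Ω, closure Ω ∈ nhds x := fun x hx =>
    Filter.mem_of_superset (hop.mem_nhds hx) subset_closure
  have haΩ : a ∉ Ω := fun h =>
    (hdet a h).not_ge ((hamax.isLocalMax (hnhds a h)).det_hess_nonneg (hC a h))
  have hbΩ : b ∉ Ω := fun h =>
    (hdet b h).not_ge ((hbmin.isLocalMin (hnhds b h)).det_hess_nonneg (hC b h))
  obtain ⟨p, hp⟩ := hne
  have hpmax : IsMaxOn f (closure Ω) p := fun x hx =>
    calc f x ≤ f a := hamax hx
      _ = f b := by rw [hfront a ha haΩ, hfront b hb hbΩ]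
      _ ≤ f p := hbmin (subset_closure hp)
  exact (hdet p hp).not_ge ((hpmax.isLocalMax (hnhds p hp)).det_hess_nonneg (hC p hp))

end
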